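/- For any oracle A ⊆ ℕ and any function f : {0,1}* × ℕ → ℕ partial recursive in A, the partial function max f (sending p to the maximum of {f(p,t) : t ∈ ℕ} when it is finite, undefined otherwise) is partial recursive in the jump A′. Moreover the inclusion of the class of such max functions into the class of partial A′-recursive functions {0,1}* → ℕ is strict. -/

import Mathlib

/-- Codes for oracle partial recursive functions: `Nat.Partrec.Code` with an
extra constructor for one call to the oracle. -/
inductive OCode : Type
  | zero | succ | left | right | oracle
  | pair : OCode → OCode → OCode
  | comp : OCode → OCode → OCode
  | prec : OCode → OCode → OCode
  | rfind' : OCode → OCode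

/-- Evaluation of an oracle code, relative to the oracle `O`. -/
def evalo (O : ℕ →. ℕ) : OCode → ℕ →. ℕ
  | .zero => fun _ => Part.some 0
  | .succ => fun n => Part.some (n + 1)
  | .left => fun n => Part.some (Nat.unpair n).1
  | .right => fun n => Part.some (Nat.unpair n).2
  | .oracle => O
  | .pair cf cg => fun n => Nat.pair <$> evalo O cf n <*> evalo O cg n
  | .comp cf cg => fun n => evalo O cg n >>= evalo O cf
  | .prec cf cg => Nat.unpaired fun a n =>
      n.rec (evalo O cf a) fun y IH => do
        let i ← IH
        evalo O cg (Nat.pair a (Nat.pair y i))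
  | .rfind' cf => Nat.unpaired fun a m =>
      (Nat.rfind fun n => (fun x => x = 0) <$> evalo O cf (Nat.pair a (n + m))).map (· + m)

open Classical in
/-- The characteristic (total) partial function of a set of naturals. -/
noncomputable def chi (A : Set ℕ) : ℕ →. ℕ :=
  fun n => Part.some (if n ∈ A then 1 else 0)

/-- `f` is partial `A`-recursive (via encodings of `α` and `β`). -/
def RecInP {α β : Type*} [Primcodable α] [Primcodable β] (A : Set ℕ) (f : α →. β) : Prop :=
  ∃ c : OCode, ∀ a : α,
    evalo (chi A) c (Encodable.encode a) = (f a).map Encodable.encode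

/-- An injective encoding of oracle codes into ℕ. -/
def encOCode : OCode → ℕ
  | .zero => 0
  | .succ => 1
  | .left => 2
  | .right => 3
  | .oracle => 4
  | .pair a b => 4 * Nat.pair (encOCode a) (encOCode b) + 5
  | .comp a b => 4 * Nat.pair (encOCode a) (encOCode b) + 6
  | .prec a b => 4 * Nat.pair (encOCode a) (encOCode b) + 7
  | .rfind' a => 4 * encOCode a + 8

/-- The Turing jump A′ of A : the self-halting set relative to A. -/
def jump (A : Set ℕ) : Set ℕ :=
  {n | ∃ c : OCode, encOCode c = n ∧ (evalo (chi A) c n).Dom}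

/-- The acceptable enumeration of A-r.e. subsets of ℕ: `W A e` is the domain of the
A-partial recursive function coded by `e`. -/
def W (A : Set ℕ) (e : ℕ) : Set ℕ :=
  {n | ∃ c : OCode, encOCode c = e ∧ (evalo (chi A) c n).Dom}

/-- The max of a set of naturals, as a partial value. -/
noncomputable def pmax (S : Set ℕ) : Part ℕ := ⟨S.Nonempty ∧ BddAbove S, fun _ => sSup S⟩

/-- (max f)(p) : max of {y : ∃ t, f(p,t) = y} when this set is finite, undefined otherwise. -/
noncomputable def maxOfP (f : List Bool × ℕ →. ℕ) : List Bool →. ℕ :=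
  fun p => pmax {y | ∃ t, y ∈ f (p, t)}

open Filter

theorem mem_evalo_pair {O : ℕ →. ℕ} {cf cg : OCode} {n y : ℕ} :
    y ∈ evalo O (.pair cf cg) n ↔
      ∃ a ∈ evalo O cf n, ∃ b ∈ evalo O cg n, Nat.pair a b = y := by
  simp [evalo, Seq.seq]

theorem evalo_comp (O : ℕ →. ℕ) (cf cg : OCode) (n : ℕ) :
    evalo O (.comp cf cg) n = (evalo O cg n).bind fun a => evalo O cf a := rfl

theorem evalo_prec_zero (O : ℕ →. ℕ) (cf cg : OCode) (a : ℕ) :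
    evalo O (.prec cf cg) (Nat.pair a 0) = evalo O cf a := by
  simp [evalo]

theorem evalo_prec_succ (O : ℕ →. ℕ) (cf cg : OCode) (a m : ℕ) :
    evalo O (.prec cf cg) (Nat.pair a (m + 1)) = (evalo O (.prec cf cg) (Nat.pair a m)).bind
      fun i => evalo O cg (Nat.pair a (Nat.pair m i)) := by
  simp [evalo]

theorem evalo_rfind' (O : ℕ →. ℕ) (cf : OCode) (a m : ℕ) :
    evalo O (.rfind' cf) (Nat.pair a m) = (Nat.rfind fun n =>
      (evalo O cf (Nat.pair a (n + m))).map fun x => decide (x = 0)).map (· + m) := by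
  simp [evalo]

theorem mem_evalo_rfind' {O : ℕ →. ℕ} {cf : OCode} {a m y : ℕ} :
    y ∈ evalo O (.rfind' cf) (Nat.pair a m) ↔ ∃ k, 0 ∈ evalo O cf (Nat.pair a (k + m)) ∧
      (∀ j < k, ∃ z ∈ evalo O cf (Nat.pair a (j + m)), z ≠ 0) ∧ k + m = y := by
  rw [evalo_rfind', Part.mem_map_iff]
  refine exists_congr fun k => ?_
  rw [← and_assoc]
  refine and_congr_left fun _ => Nat.mem_rfind.trans ?_
  simp

theorem evalo_comp_of_eq_some {O : ℕ →. ℕ} {cf cg : OCode} {n a : ℕ}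
    (h : evalo O cg n = Part.some a) : evalo O (.comp cf cg) n = evalo O cf a := by
  rw [evalo_comp, h, Part.bind_some]

theorem evalo_pair_of_eq_some {O : ℕ →. ℕ} {cf cg : OCode} {n a b : ℕ}
    (hf : evalo O cf n = Part.some a) (hg : evalo O cg n = Part.some b) :
    evalo O (.pair cf cg) n = Part.some (Nat.pair a b) := by
  simp [evalo, hf, hg, Seq.seq]

/-- Evaluation is monotone and continuous in the oracle. -/
theorem eventually_mem_evalo {ι : Type*} {l : Filter ι} {O : ℕ →. ℕ} {P : ι → ℕ →. ℕ}
    (h : ∀ n, ∀ y ∈ O n, ∀ᶠ i in l, y ∈ P i n) (c : OCode) :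
    ∀ n, ∀ y ∈ evalo O c n, ∀ᶠ i in l, y ∈ evalo (P i) c n := by
  induction c with
  | zero | succ | left | right => exact fun n y hy => Eventually.of_forall fun i => hy
  | oracle => exact h
  | pair cf cg hf hg =>
    intro n y hy
    obtain ⟨a, ha, b, hb, rfl⟩ := mem_evalo_pair.1 hy
    filter_upwards [hf n a ha, hg n b hb] with i h1 h2
    exact mem_evalo_pair.2 ⟨a, h1, b, h2, rfl⟩
  | comp cf cg hf hg =>
    intro n y hy
    obtain ⟨a, ha, hb⟩ := Part.mem_bind_iff.1 hy
    filter_upwards [hg n a ha, hf a y hb] with i h1 h2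
    exact Part.mem_bind_iff.2 ⟨a, h1, h2⟩
  | prec cf cg hf hg =>
    intro n
    rw [← Nat.pair_unpair n]
    generalize n.unpair.1 = a
    induction n.unpair.2 with
    | zero => simpa only [evalo_prec_zero] using hf a
    | succ m ih =>
      simp only [evalo_prec_succ, Part.mem_bind_iff]
      rintro y ⟨b, hb, hy⟩
      filter_upwards [ih b hb, hg _ y hy] with i h1 h2
      exact ⟨b, h1, h2⟩
  | rfind' cf hf =>
    intro n
    rw [← Nat.pair_unpair n]
    simp only [mem_evalo_rfind']
    rintro y ⟨k, h0, hlt, rfl⟩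
    choose z hz hz' using hlt
    have hall : ∀ᶠ i in l, ∀ m : Fin k, z m m.2 ∈ evalo (P i) cf
        (Nat.pair n.unpair.1 (m + n.unpair.2)) :=
      eventually_all.2 fun m => hf _ _ (hz m m.2)
    filter_upwards [hf _ 0 h0, hall] with i h1 h2
    exact ⟨k, h1, fun m hm => ⟨_, h2 ⟨m, hm⟩, hz' m hm⟩, rfl⟩

/-- Evaluation relative to a finite partial oracle, given by a list of answers, is partial
recursive in the list and the argument. -/
theorem partrec₂_evalo_list (c : OCode) :
    Partrec₂ fun (σ : List ℕ) n => evalo (fun i => (σ[i]? : Part ℕ)) c n := by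
  have hleft : Computable fun n : ℕ => n.unpair.1 := Computable.fst.comp Computable.unpair
  have hright : Computable fun n : ℕ => n.unpair.2 := Computable.snd.comp Computable.unpair
  have hpair : Computable₂ Nat.pair := Primrec₂.natPair.to_comp
  induction c with
  | zero => exact (Computable.const 0).partrec
  | succ => exact (Computable.succ.comp Computable.snd).partrec
  | left => exact (hleft.comp Computable.snd).partrec
  | right => exact (hright.comp Computable.snd).partrec
  | oracle => exact Computable.ofOption Computable.list_getElem?
  | pair cf cg hf hg =>
    refine (Partrec.bind hf (Partrec.map (hg.comp (Computable.fst.comp Computable.fst)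
      (Computable.snd.comp Computable.fst)) (hpair.comp (Computable.snd.comp Computable.fst)
        Computable.snd).to₂).to₂).of_eq fun a => ?_
    simp [evalo, Seq.seq]
  | comp cf cg hf hg =>
    exact Partrec.bind hg (hf.comp (Computable.fst.comp Computable.fst) Computable.snd)
  | prec cf cg hf hg =>
    exact Partrec.nat_rec (hright.comp Computable.snd)
      (hf.comp Computable.fst (hleft.comp Computable.snd))
      (hg.comp (Computable.fst.comp Computable.fst)
        (hpair.comp (hleft.comp (Computable.snd.comp Computable.fst))
          (hpair.comp (Computable.fst.comp Computable.snd)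
            (Computable.snd.comp Computable.snd)))).to₂
  | rfind' cf hf =>
    have add : Computable₂ fun a b : ℕ => a + b := Primrec.nat_add.to_comp
    have iszero : Computable fun x : ℕ => decide (x = 0) :=
      (Primrec.eq.decide.comp Primrec.id (Primrec.const 0)).to_comp
    refine Partrec.map (Partrec.rfind (Partrec.map (hf.comp (Computable.fst.comp Computable.fst)
      (hpair.comp (hleft.comp (Computable.snd.comp Computable.fst))
        (add.comp Computable.snd (hright.comp (Computable.snd.comp Computable.fst)))))
      (iszero.comp Computable.snd).to₂).to₂)
      (add.comp Computable.snd (hright.comp (Computable.snd.comp Computable.fst))).to₂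

open Classical in
/-- The characteristic function of `A`, with values in `ℕ`. -/
noncomputable def charFun (A : Set ℕ) : ℕ → ℕ := fun n => if n ∈ A then 1 else 0

theorem chi_eq (A : Set ℕ) (n : ℕ) : chi A n = Part.some (charFun A n) :=
  rfl

/-- The list of the first `L` answers of the oracle `A`. -/
noncomputable def initSeg (A : Set ℕ) (L : ℕ) : List ℕ := (List.range L).map (charFun A)

theorem mem_initSeg_getElem? {A : Set ℕ} {L i y : ℕ} :
    y ∈ ((initSeg A L)[i]? : Part ℕ) ↔ i < L ∧ y = charFun A i := by
  rw [Part.mem_ofOption]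
  by_cases h : i < L <;> simp [initSeg, h, eq_comm]

/-- The use principle. -/
theorem mem_evalo_chi_iff {A : Set ℕ} {c : OCode} {n y : ℕ} :
    y ∈ evalo (chi A) c n ↔
      ∃ L, y ∈ evalo (fun i => ((initSeg A L)[i]? : Part ℕ)) c n := by
  constructor
  · intro h
    refine (eventually_mem_evalo (l := atTop)
      (P := fun L i => ((initSeg A L)[i]? : Part ℕ)) ?_ c n y h).exists
    intro i y hy
    rw [chi_eq, Part.mem_some_iff] at hy
    filter_upwards [eventually_gt_atTop i] with L hL
    exact mem_initSeg_getElem?.2 ⟨hL, hy⟩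
  · rintro ⟨L, h⟩
    have := eventually_mem_evalo (l := pure ()) (P := fun _ => chi A) ?_ c n y h
    · exact eventually_pure.1 this
    · intro i y hy
      rw [eventually_pure, chi_eq, Part.mem_some_iff]
      exact (mem_initSeg_getElem?.1 hy).2

/-- Kleene's normal form: convergence relative to `A` is witnessed by an initial segment of `A`
and a number of steps. -/
theorem exists_normalForm (c : OCode) :
    ∃ T : List ℕ × ℕ × ℕ → Option ℕ, Computable T ∧ ∀ (A : Set ℕ) (n y : ℕ),
      y ∈ evalo (chi A) c n ↔ ∃ L k, y ∈ T (initSeg A L, n, k) := by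
  obtain ⟨e, he⟩ := Nat.Partrec.Code.exists_code.1 (partrec₂_evalo_list c)
  refine ⟨fun p => Nat.Partrec.Code.evaln p.2.2 e (Encodable.encode (p.1, p.2.1)), ?_, ?_⟩
  · exact Nat.Partrec.Code.primrec_evaln.to_comp.comp
      (((Computable.snd.comp Computable.snd).pair (Computable.const e)).pair
        (Computable.encode.comp (Computable.fst.pair (Computable.fst.comp Computable.snd))))
  · intro A n y
    rw [mem_evalo_chi_iff]
    refine exists_congr fun L => ?_
    have := Nat.Partrec.Code.evaln_complete (c := e) (n := Encodable.encode (initSeg A L, n))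
      (x := y)
    rw [he] at this
    refine Iff.trans ?_ this
    simp

theorem exists_evalo_eq {f : ℕ →. ℕ} (hf : Nat.Partrec f) (O : ℕ →. ℕ) :
    ∃ c : OCode, evalo O c = f := by
  induction hf with
  | zero => exact ⟨.zero, rfl⟩
  | succ => exact ⟨.succ, rfl⟩
  | left => exact ⟨.left, rfl⟩
  | right => exact ⟨.right, rfl⟩
  | pair _ _ hf hg =>
    obtain ⟨cf, rfl⟩ := hf
    obtain ⟨cg, rfl⟩ := hg
    exact ⟨.pair cf cg, rfl⟩
  | comp _ _ hf hg =>
    obtain ⟨cf, rfl⟩ := hf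
    obtain ⟨cg, rfl⟩ := hg
    exact ⟨.comp cf cg, rfl⟩
  | prec _ _ hf hg =>
    obtain ⟨cf, rfl⟩ := hf
    obtain ⟨cg, rfl⟩ := hg
    exact ⟨.prec cf cg, rfl⟩
  | rfind _ hf =>
    obtain ⟨cf, rfl⟩ := hf
    refine ⟨.comp (.rfind' cf) (.pair (.pair .left .right) .zero), funext fun n => ?_⟩
    rw [evalo_comp_of_eq_some (evalo_pair_of_eq_some (evalo_pair_of_eq_some rfl rfl) rfl),
      evalo_rfind', Nat.pair_unpair]
    exact Part.map_id' (fun _ => rfl) _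

/-- Total functions recursive in `A`. -/
def TotalRecIn (A : Set ℕ) (f : ℕ → ℕ) : Prop :=
  ∃ c : OCode, ∀ n, evalo (chi A) c n = Part.some (f n)

namespace TotalRecIn

variable {A : Set ℕ} {f g : ℕ → ℕ}

theorem of_computable (hf : Computable f) : TotalRecIn A f := by
  obtain ⟨c, hc⟩ := exists_evalo_eq (Partrec.nat_iff.1 hf.partrec) (chi A)
  exact ⟨c, fun n => by rw [hc]; rfl⟩

theorem oracle : TotalRecIn A (charFun A) := ⟨.oracle, chi_eq A⟩

theorem comp (hf : TotalRecIn A f) (hg : TotalRecIn A g) : TotalRecIn A fun n => f (g n) := by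
  obtain ⟨cf, hf⟩ := hf
  obtain ⟨cg, hg⟩ := hg
  exact ⟨.comp cf cg, fun n => (evalo_comp_of_eq_some (hg n)).trans (hf _)⟩

theorem pair (hf : TotalRecIn A f) (hg : TotalRecIn A g) :
    TotalRecIn A fun n => Nat.pair (f n) (g n) := by
  obtain ⟨cf, hf⟩ := hf
  obtain ⟨cg, hg⟩ := hg
  exact ⟨.pair cf cg, fun n => evalo_pair_of_eq_some (hf n) (hg n)⟩

theorem encode_initSeg : TotalRecIn A fun L => Encodable.encode (initSeg A L) := by
  have hstep : Computable fun z : ℕ =>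
      Encodable.encode (((Encodable.decode (α := List ℕ) z.unpair.1).getD []) ++ [z.unpair.2]) :=
    Computable.encode.comp (Computable.list_concat.comp
      (Computable.option_getD (Computable.decode.comp (Computable.fst.comp Computable.unpair))
        (Computable.const []))
      (Computable.snd.comp Computable.unpair))
  have hleft : Computable fun n : ℕ => n.unpair.1 := Computable.fst.comp Computable.unpair
  have hright : Computable fun n : ℕ => n.unpair.2 := Computable.snd.comp Computable.unpair
  obtain ⟨s, hs⟩ := (of_computable (A := A) hstep).comp
    (((of_computable (hright.comp hright))).pair
      (oracle.comp (of_computable (hleft.comp hright))))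
  obtain ⟨z, hz⟩ := of_computable (A := A) (Computable.const (Encodable.encode ([] : List ℕ)))
  obtain ⟨p, hp⟩ := (of_computable (A := A) (Computable.const 0)).pair
    (of_computable Computable.id)
  refine ⟨.comp (.prec z s) p, fun L => ?_⟩
  rw [evalo_comp_of_eq_some (hp L)]
  change evalo (chi A) _ (Nat.pair 0 L) = _
  induction L with
  | zero => rw [evalo_prec_zero, hz]; rfl
  | succ L ih =>
    rw [evalo_prec_succ, ih, Part.bind_some, hs]
    simp [initSeg, List.range_succ]

theorem exists_rfind (hf : TotalRecIn A f) :
    ∃ c : OCode, ∀ n, evalo (chi A) c n =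
      Nat.rfind fun m => Part.some (decide (f (Nat.pair n m) = 0)) := by
  obtain ⟨c, hc⟩ := hf
  obtain ⟨p, hp⟩ := (of_computable (A := A) Computable.id).pair
    (of_computable (Computable.const 0))
  refine ⟨.comp (.rfind' c) p, fun n => ?_⟩
  rw [evalo_comp_of_eq_some (hp n), evalo_rfind']
  simp only [hc, Part.map_some, Nat.add_zero]
  exact Part.map_id' (fun _ => rfl) _

end TotalRecIn

/-- Sets that are `Σ₁` relative to `A` are domains of `A`-recursive functions. -/
theorem exists_dom_iff (A : Set ℕ) {R : List ℕ × ℕ × ℕ → Bool} (hR : Computable R) :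
    ∃ d : OCode, ∀ n, (evalo (chi A) d n).Dom ↔ ∃ L m, R (initSeg A L, n, m) = true := by
  have hleft : Computable fun n : ℕ => n.unpair.1 := Computable.fst.comp Computable.unpair
  have hright : Computable fun n : ℕ => n.unpair.2 := Computable.snd.comp Computable.unpair
  have hr : Computable fun z : ℕ => cond
      (R ((Encodable.decode (α := List ℕ) z.unpair.1).getD [], z.unpair.2.unpair.1,
        z.unpair.2.unpair.2.unpair.2)) 0 1 :=
    Computable.cond (hR.comp ((Computable.option_getD (Computable.decode.comp hleft)
      (Computable.const [])).pair ((hleft.comp hright).pair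
        (hright.comp (hright.comp hright))))) (Computable.const 0) (Computable.const 1)
  obtain ⟨d, hd⟩ := ((TotalRecIn.of_computable (A := A) hr).comp
    ((TotalRecIn.encode_initSeg.comp (TotalRecIn.of_computable (hleft.comp hright))).pair
      (TotalRecIn.of_computable Computable.id))).exists_rfind
  refine ⟨d, fun n => ?_⟩
  rw [hd]
  refine Nat.rfind_dom.trans ⟨?_, ?_⟩
  · rintro ⟨q, h, -⟩
    refine ⟨q.unpair.1, q.unpair.2, ?_⟩
    simpa [Bool.cond_eq_ite] using h
  · rintro ⟨L, m, h⟩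
    exact ⟨Nat.pair L m, by simp [h], fun _ => trivial⟩

/-- The numbers `Nat.pair a y` such that some value of the `a`-th section is at least `y` form a
set that is r.e. in `A`. -/
theorem exists_dom_iff_exists_ge (A : Set ℕ) (c : OCode) :
    ∃ d : OCode, ∀ a y, (evalo (chi A) d (Nat.pair a y)).Dom ↔
      ∃ t, ∃ v ∈ evalo (chi A) c (Nat.pair a t), y ≤ v := by
  have hleft : Computable fun n : ℕ => n.unpair.1 := Computable.fst.comp Computable.unpair
  have hright : Computable fun n : ℕ => n.unpair.2 := Computable.snd.comp Computable.unpair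
  obtain ⟨T, hT, hTc⟩ := exists_normalForm c
  let R : List ℕ × ℕ × ℕ → Bool := fun p =>
    ((T (p.1, Nat.pair p.2.1.unpair.1 p.2.2.unpair.1, p.2.2.unpair.2)).map
      fun v => decide (p.2.1.unpair.2 ≤ v)).getD false
  have h1 : Computable fun p : List ℕ × ℕ × ℕ => p.2.1 := Computable.fst.comp Computable.snd
  have h2 : Computable fun p : List ℕ × ℕ × ℕ => p.2.2 := Computable.snd.comp Computable.snd
  have hR : Computable R :=
    Computable.option_getD (Computable.option_map
      (hT.comp (Computable.fst.pair ((Primrec₂.natPair.to_comp.comp (hleft.comp h1)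
        (hleft.comp h2)).pair (hright.comp h2))))
      (Primrec.nat_le.decide.to_comp.comp (hright.comp (h1.comp Computable.fst))
        Computable.snd).to₂) (Computable.const false)
  obtain ⟨d, hd⟩ := exists_dom_iff A hR
  refine ⟨d, fun a y => ?_⟩
  rw [hd]
  have hRiff : ∀ L m, R (initSeg A L, Nat.pair a y, m) = true ↔
      ∃ v ∈ T (initSeg A L, Nat.pair a m.unpair.1, m.unpair.2), y ≤ v := by
    intro L m
    simp only [R, Nat.unpair_pair]
    cases T (initSeg A L, Nat.pair a m.unpair.1, m.unpair.2) <;> simp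
  simp only [hRiff, hTc]
  constructor
  · rintro ⟨L, m, v, hv, hy⟩
    exact ⟨_, v, ⟨L, _, hv⟩, hy⟩
  · rintro ⟨t, v, ⟨L, k, hv⟩, hy⟩
    exact ⟨L, Nat.pair t k, v, by simpa using hv, hy⟩

theorem encOCode_injective : Function.Injective encOCode := by
  intro c
  induction c with
  | pair a b iha ihb | comp a b iha ihb | prec a b iha ihb =>
    intro d h
    cases d <;> simp only [encOCode] at h <;> try omega
    rename_i a' b'
    obtain ⟨h1, h2⟩ := Nat.pair_eq_pair.1
      (show Nat.pair (encOCode a) (encOCode b) = Nat.pair (encOCode a') (encOCode b') by omega)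
    rw [iha h1, ihb h2]
  | rfind' a iha =>
    intro d h
    cases d <;> simp only [encOCode] at h <;> try omega
    rename_i a'
    rw [iha (show encOCode a = encOCode a' by omega)]
  | _ =>
    intro d h
    cases d <;> simp only [encOCode] at h <;> first | rfl | omega

theorem encOCode_mem_jump {A : Set ℕ} {c : OCode} :
    encOCode c ∈ jump A ↔ (evalo (chi A) c (encOCode c)).Dom :=
  ⟨fun ⟨_, h, hd⟩ => encOCode_injective h ▸ hd, fun h => ⟨c, rfl, h⟩⟩

/-- A code for the constant function `n`. -/
def OCode.const : ℕ → OCode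
  | 0 => .zero
  | n + 1 => .comp .succ (.const n)

theorem evalo_const (O : ℕ →. ℕ) (n m : ℕ) : evalo O (.const n) m = Part.some n := by
  induction n with
  | zero => rfl
  | succ n ih => exact evalo_comp_of_eq_some ih

theorem computable_encOCode_const : Computable fun n => encOCode (.const n) := by
  have hstep : Computable₂ fun (_ : ℕ) (p : ℕ × ℕ) => 4 * Nat.pair 1 p.2 + 6 :=
    (Primrec.nat_add.comp (Primrec.nat_mul.comp (Primrec.const 4) (Primrec₂.natPair.comp
      (Primrec.const 1) (Primrec.snd.comp Primrec.snd))) (Primrec.const 6)).to_comp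
  refine (Computable.nat_rec Computable.id (Computable.const 0) hstep).of_eq fun n => ?_
  induction n with
  | zero => rfl
  | succ n ih => simpa [OCode.const, encOCode] using ih

/-- Every set that is r.e. in `A` is many-one reducible to the jump of `A`. -/
theorem exists_computable_mem_jump_iff (A : Set ℕ) (d : OCode) :
    ∃ r : ℕ → ℕ, Computable r ∧ ∀ n, r n ∈ jump A ↔ (evalo (chi A) d n).Dom := by
  refine ⟨fun n => encOCode (.comp d (.const n)), ?_, fun n => ?_⟩
  · exact Primrec.nat_add.to_comp.comp (Primrec.nat_mul.to_comp.comp (Computable.const 4)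
      (Primrec₂.natPair.to_comp.comp (Computable.const _) computable_encOCode_const))
      (Computable.const 6)
  · rw [encOCode_mem_jump]
    exact iff_of_eq (congrArg Part.Dom (evalo_comp_of_eq_some (evalo_const _ n _)))

theorem mem_pmax_iff {S : Set ℕ} {y : ℕ} : y ∈ pmax S ↔ IsGreatest S y := by
  constructor
  · rintro ⟨⟨hne, hb⟩, rfl⟩
    exact ⟨Nat.sSup_mem hne hb, fun _ hx => le_csSup hb hx⟩
  · exact fun h => ⟨⟨⟨y, h.1⟩, ⟨y, h.2⟩⟩, h.csSup_eq⟩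

theorem RecInP.jump_maxOfP {A : Set ℕ} {f : List Bool × ℕ →. ℕ} (hf : RecInP A f) :
    RecInP (jump A) (maxOfP f) := by
  obtain ⟨c, hc⟩ := hf
  obtain ⟨d, hd⟩ := exists_dom_iff_exists_ge A c
  obtain ⟨r, hr, hrd⟩ := exists_computable_mem_jump_iff A d
  have hright : Computable fun n : ℕ => n.unpair.2 := Computable.snd.comp Computable.unpair
  have hleft : Computable fun n : ℕ => n.unpair.1 := Computable.fst.comp Computable.unpair
  have hcomb : Computable fun z : ℕ => (1 - z.unpair.1) + z.unpair.2 :=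
    Primrec.nat_add.to_comp.comp
      (Primrec.nat_sub.to_comp.comp (Computable.const 1) hleft) hright
  have hnext : Computable fun z : ℕ => r (Nat.pair z.unpair.1 (z.unpair.2 + 1)) :=
    hr.comp (Primrec₂.natPair.to_comp.comp hleft (Computable.succ.comp hright))
  obtain ⟨e, he⟩ := ((TotalRecIn.of_computable (A := jump A) hcomb).comp
    ((TotalRecIn.oracle.comp (TotalRecIn.of_computable hr)).pair
      (TotalRecIn.oracle.comp (TotalRecIn.of_computable hnext)))).exists_rfind
  refine ⟨e, fun p => ?_⟩
  have hge : ∀ y, r (Nat.pair (Encodable.encode p) y) ∈ jump A ↔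
      ∃ v, (∃ t, v ∈ f (p, t)) ∧ y ≤ v := by
    intro y
    rw [hrd, hd]
    have : ∀ t, evalo (chi A) c (Nat.pair (Encodable.encode p) t) = f (p, t) := fun t =>
      (hc (p, t)).trans (Part.map_id' (fun _ => rfl) _)
    simp only [this]
    tauto
  rw [show (maxOfP f p).map Encodable.encode = maxOfP f p from Part.map_id' (fun _ => rfl) _, he]
  have hiff : ∀ y, (1 - charFun (jump A) (r (Nat.pair (Encodable.encode p) y)) +
      charFun (jump A) (r (Nat.pair (Encodable.encode p) (y + 1))) = 0) ↔
      y ∈ maxOfP f p := by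
    intro y
    have : (1 - charFun (jump A) (r (Nat.pair (Encodable.encode p) y)) +
      charFun (jump A) (r (Nat.pair (Encodable.encode p) (y + 1))) = 0) ↔
      r (Nat.pair (Encodable.encode p) y) ∈ jump A ∧
      r (Nat.pair (Encodable.encode p) (y + 1)) ∉ jump A := by
      by_cases h : r (Nat.pair (Encodable.encode p) y) ∈ jump A <;> simp [charFun, h]
    rw [this, hge, hge, maxOfP, mem_pmax_iff]
    constructor
    · rintro ⟨⟨v, hv, hyv⟩, hn⟩
      have hub : ∀ w, (∃ t, w ∈ f (p, t)) → w ≤ y := fun w hw =>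
        not_lt.1 fun hlt => hn ⟨w, hw, hlt⟩
      exact ⟨le_antisymm (hub v hv) hyv ▸ hv, fun w hw => hub w hw⟩
    · rintro ⟨hy, hub⟩
      exact ⟨⟨y, hy, le_rfl⟩, fun ⟨w, hw, hlt⟩ => (Nat.lt_irrefl _) (hlt.trans (hub hw))⟩
  refine Part.ext fun y => Nat.mem_rfind.trans ?_
  simp only [Nat.unpair_pair, hiff, Part.mem_some_iff, true_eq_decide_iff, false_eq_decide_iff]
  exact ⟨fun h => h.1, fun h => ⟨h, fun hm h' => hm.ne (Part.mem_unique h' h)⟩⟩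

/-- The characteristic function of the complement of the jump of `A`, on lengths of strings, is
not the maximum of a partial `A`-recursive function. -/
theorem RecInP.maxOfP_ne {A : Set ℕ} {f : List Bool × ℕ →. ℕ} (hf : RecInP A f) :
    maxOfP f ≠ fun p => Part.some (1 - charFun (jump A) p.length) := by
  intro heq
  obtain ⟨c, hc⟩ := hf
  obtain ⟨d, hd⟩ := exists_dom_iff_exists_ge A c
  have hrep : Computable fun n : ℕ => Encodable.encode (List.replicate n true) := by
    have : Computable fun n : ℕ => (List.range n).map fun _ => true :=
      (Primrec.list_map Primrec.list_range (Primrec.const true).to₂).to_comp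
    exact Computable.encode.comp (this.of_eq fun n => by simp)
  obtain ⟨q, hq⟩ := (TotalRecIn.of_computable (A := A) hrep).pair
    (TotalRecIn.of_computable (Computable.const 1))
  have hself := encOCode_mem_jump (A := A) (c := .comp d q)
  generalize encOCode (.comp d q) = n at hself
  have hev : ∀ t, evalo (chi A) c (Nat.pair (Encodable.encode (List.replicate n true)) t) =
      f (List.replicate n true, t) := fun t =>
    (hc (List.replicate n true, t)).trans (Part.map_id' (fun _ => rfl) _)
  simp only [evalo_comp_of_eq_some (hq n), hd, hev] at hself
  have hmax : IsGreatest {y | ∃ t, y ∈ f (List.replicate n true, t)}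
      (1 - charFun (jump A) n) := by
    rw [← mem_pmax_iff]
    change _ ∈ maxOfP f (List.replicate n true)
    simp [heq]
  by_cases hn : n ∈ jump A
  · obtain ⟨t, v, hv, h1⟩ := hself.1 hn
    have := hmax.2 ⟨t, hv⟩
    simp [charFun, hn] at this
    omega
  · obtain ⟨t, ht⟩ := hmax.1
    exact hn (hself.2 ⟨t, _, ht, by simp [charFun, hn]⟩)

theorem recInP_one_sub_charFun_length (B : Set ℕ) :
    RecInP B fun p : List Bool => Part.some (1 - charFun B p.length) := by
  have hlen : Computable fun z : ℕ =>
      ((Encodable.decode (α := List Bool) z).getD []).length :=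
    Computable.list_length.comp (Computable.option_getD Computable.decode (Computable.const []))
  have hsub : Computable fun z : ℕ => 1 - z :=
    Primrec.nat_sub.to_comp.comp (Computable.const 1) Computable.id
  obtain ⟨c, hc⟩ := (TotalRecIn.of_computable (A := B) hsub).comp
    (TotalRecIn.oracle.comp (TotalRecIn.of_computable hlen))
  exact ⟨c, fun p => by simp [hc]⟩

theorem stmt6 (A : Set ℕ) :
    (∀ f : List Bool × ℕ →. ℕ, RecInP A f → RecInP (jump A) (maxOfP f)) ∧
    ∃ G : List Bool →. ℕ, RecInP (jump A) G ∧
      ∀ f : List Bool × ℕ →. ℕ, RecInP A f → maxOfP f ≠ G := by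
  exact ⟨fun f hf => hf.jump_maxOfP, _, recInP_one_sub_charFun_length (jump A),
    fun f hf => hf.maxOfP_ne⟩
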